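/- arXiv:2402.16588 — 2 statements merged into one kernel-verified Lean document; each statement's English description precedes it below -/
import Mathlib

section
/- Let n ≥ 4 be an integer and ε ∈ [2/(3(2n+1)), 2/(3(2n-1))). Let Δ₁₉ be the closed triangle in ℝ² with vertices W = (ε, 1), Z = (2/3-ε, 5/3-2ε), and V₂ = (2/3-ε, 5/3-2ε-2ε/n). Then Δ₁₉ ∩ D⁰_{2,ε} = Δ₁₉ \ [W,Z], where [W,Z] is the closed line segment from W to Z. -/
/-- The map `τ_{r,ε}(z₁,z₂) = (z₂, -⌊r₁z₁ + r₂z₂ + ε⌋)`. -/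
noncomputable def tau2 (r : ℝ × ℝ) (ε : ℝ) (z : ℤ × ℤ) : ℤ × ℤ :=
  (z.2, -⌊r.1 * (z.1 : ℝ) + r.2 * (z.2 : ℝ) + ε⌋)

/-- `D⁰_{2,ε}`: the set of `r ∈ ℝ²` such that every orbit of `τ_{r,ε}` reaches `(0,0)`. -/
def SRS2 (ε : ℝ) : Set (ℝ × ℝ) :=
  {r | ∀ z : ℤ × ℤ, ∃ k : ℕ, (tau2 r ε)^[k] z = (0, 0)}


/-- Parameter assumptions. -/
structure Par (x η ε : ℝ) : Prop where
  e0 : 0 < ε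
  e1 : ε < 2/21
  h0 : ε < η
  h1 : η ≤ 3/2 * ε
  x0 : ε < x
  x1 : x ≤ 2/3 - ε

/-- Reaches zero. -/
def Rch (x η ε : ℝ) (z : ℤ × ℤ) : Prop := ∃ k : ℕ, (tau2 (x, x + 1 - η) ε)^[k] z = (0, 0)

lemma Rch.step {x η ε : ℝ} {z : ℤ × ℤ} (h : Rch x η ε (tau2 (x, x + 1 - η) ε z)) :
    Rch x η ε z := by
  obtain ⟨k, hk⟩ := h
  exact ⟨k + 1, by rwa [Function.iterate_succ_apply]⟩

/-- type A state -/
def TA (x η ε : ℝ) (m u : ℤ) : Prop := Rch x η ε (u + m, -m)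
/-- type B state -/
def TB (x η ε : ℝ) (m u : ℤ) : Prop := Rch x η ε (-u - m, m)

lemma stepA {x η ε : ℝ} {m u : ℤ} (w : ℤ) (h1 : (w:ℝ) ≤ x * u + η * m + ε)
    (h2 : x * u + η * m + ε < w + 1) (h : TB x η ε (m - w) w) : TA x η ε m u := by
  apply Rch.step
  have : tau2 (x, x + 1 - η) ε (u + m, -m) = (-w - (m - w), m - w) := by
    simp only [tau2, Prod.mk.injEq]
    refine ⟨by ring, ?_⟩
    have : ⌊x * ((u + m : ℤ) : ℝ) + (x + 1 - η) * ((-m : ℤ) : ℝ) + ε⌋ = w - m := by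
      rw [Int.floor_eq_iff]; push_cast; constructor <;> linarith
    rw [this]; ring
  rw [this]; exact h

lemma stepB {x η ε : ℝ} {m u : ℤ} (w : ℤ) (h1 : x * u + η * m - ε ≤ w)
    (h2 : (w:ℝ) - 1 < x * u + η * m - ε) (h : TA x η ε (m - w) w) : TB x η ε m u := by
  apply Rch.step
  have : tau2 (x, x + 1 - η) ε (-u - m, m) = (w + (m - w), -(m - w)) := by
    simp only [tau2, Prod.mk.injEq]
    refine ⟨by ring, ?_⟩
    have : ⌊x * ((-u - m : ℤ) : ℝ) + (x + 1 - η) * ((m : ℤ) : ℝ) + ε⌋ = m - w := by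
      rw [Int.floor_eq_iff]; push_cast; constructor <;> linarith
    rw [this]; 
  rw [this]; exact h

lemma stepA' {x η ε : ℝ} {m u : ℤ} 
    (h : ∀ w : ℤ, (w:ℝ) ≤ x * u + η * m + ε → x * u + η * m + ε < w + 1 → TB x η ε (m - w) w) :
    TA x η ε m u :=
  stepA ⌊x * u + η * m + ε⌋ (Int.floor_le _) (Int.lt_floor_add_one _)
    (h _ (Int.floor_le _) (Int.lt_floor_add_one _))

lemma stepB' {x η ε : ℝ} {m u : ℤ} 
    (h : ∀ w : ℤ, x * u + η * m - ε ≤ w → (w:ℝ) - 1 < x * u + η * m - ε → TA x η ε (m - w) w) :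
    TB x η ε m u := by
  have h1 := Int.le_ceil (x * u + η * m - ε)
  have h2 : ((⌈x * u + η * m - ε⌉ : ℤ) : ℝ) - 1 < x * u + η * m - ε := by
    linarith [Int.ceil_lt_add_one (x * u + η * m - ε)]
  exact stepB _ h1 h2 (h _ h1 h2)

lemma negAB {x η ε : ℝ} {m u : ℤ} : TA x η ε (-m) (-u) ↔ TB x η ε m u := by
  unfold TA TB; rw [neg_neg, sub_eq_add_neg]

lemma lt_of_real {a b : ℤ} (h : (a:ℝ) < b) : a < b := by exact_mod_cast h

lemma good {x η ε : ℝ} (P : Par x η ε) (N : ℕ) : ∀ m : ℤ, 0 ≤ m → m ≤ N → η * m < 2/3 + ε →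
    (∀ u : ℤ, 0 ≤ u → u ≤ 1 → (m = 0 → u = 0) → TB x η ε m u) ∧
    (∀ u : ℤ, 0 ≤ u → u ≤ 2 → (u = 2 → 2 ≤ m) → TA x η ε m u) := by
  obtain ⟨e0, e1, h0, h1, x0, x1⟩ := P
  have P : Par x η ε := ⟨e0, e1, h0, h1, x0, x1⟩
  have zB : TB x η ε 0 0 := ⟨0, by simp⟩
  have key : ∀ m : ℤ, 0 ≤ m → η * m < 2/3 + ε →
      (∀ m' : ℤ, 0 ≤ m' → m' ≤ m →
        ∀ u : ℤ, 0 ≤ u → u ≤ 1 → (m' = 0 → u = 0) → TB x η ε m' u) →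
      (∀ u : ℤ, 0 ≤ u → u ≤ 2 → (u = 2 → 2 ≤ m) → TA x η ε m u) := by
    intro m hm hb H u hu0 hu2 hu
    have hm' : (0:ℝ) ≤ m := by exact_mod_cast hm
    have hem : 0 ≤ η * m := mul_nonneg (by linarith) hm'
    apply stepA'
    intro w w1 w2
    have hu0' : (0:ℝ) ≤ u := by exact_mod_cast hu0
    have hu2' : (u:ℝ) ≤ 2 := by exact_mod_cast hu2
    have hxu : 0 ≤ x * u := mul_nonneg (by linarith) hu0'
    have hxu2 : x * u ≤ x * 2 := mul_le_mul_of_nonneg_left hu2' (by linarith)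
    have a1 : -1 < w := lt_of_real (by push_cast; linarith)
    have a2 : w < 2 := lt_of_real (by push_cast; linarith)
    have a3 : m ≤ 1 → w = 0 := by
      intro hm1
      have : u ≤ 1 := by omega
      have h1' : (u:ℝ) ≤ 1 := by exact_mod_cast this
      have hm1' : (m:ℝ) ≤ 1 := by exact_mod_cast hm1
      have : x * u ≤ x * 1 := mul_le_mul_of_nonneg_left h1' (by linarith)
      have : η * m ≤ η * 1 := mul_le_mul_of_nonneg_left hm1' (by linarith)
      have : w < 1 := lt_of_real (by push_cast; linarith)
      omega
    apply H <;> omega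
  induction N with
  | zero =>
    intro m hm hN hb
    have : m = 0 := by simp at hN; omega
    subst this
    have hB : ∀ u : ℤ, 0 ≤ u → u ≤ 1 → ((0:ℤ) = 0 → u = 0) → TB x η ε 0 u := by
      intro u _ _ hu
      rw [hu rfl]; exact zB
    refine ⟨hB, key 0 hm hb ?_⟩
    intro m' h1 h2
    have : m' = 0 := by omega
    subst this; exact hB
  | succ N ih =>
    have hB : ∀ m : ℤ, 0 ≤ m → m ≤ (N+1:ℕ) → η * m < 2/3 + ε →
      (∀ u : ℤ, 0 ≤ u → u ≤ 1 → (m = 0 → u = 0) → TB x η ε m u) := by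
      intro m hm hN hb u hu0 hu1 hu
      by_cases hm0 : m = 0
      · rw [hu hm0, hm0]; exact zB
      have hm1 : 1 ≤ m := by omega
      have hm' : (1:ℝ) ≤ m := by exact_mod_cast hm1
      have hem : η * 1 ≤ η * m := mul_le_mul_of_nonneg_left hm' (by linarith)
      have hu0' : (0:ℝ) ≤ u := by exact_mod_cast hu0
      have hu2' : (u:ℝ) ≤ 1 := by exact_mod_cast hu1
      have hxu : 0 ≤ x * u := mul_nonneg (by linarith) hu0'
      have hxu2 : x * u ≤ x * 1 := mul_le_mul_of_nonneg_left hu2' (by linarith)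
      apply stepB'
      intro w w1 w2
      have a1 : 0 < w := lt_of_real (by push_cast; linarith)
      have a2 : w < 3 := lt_of_real (by push_cast; linarith)
      have a3 : m ≤ 3 → w < 2 := by
        intro h3
        have h3' : (m:ℝ) ≤ 3 := by exact_mod_cast h3
        have : η * m ≤ η * 3 := mul_le_mul_of_nonneg_left h3' (by linarith)
        exact lt_of_real (by push_cast; linarith)
      have hw : (0:ℝ) ≤ w := by exact_mod_cast a1.le
      refine (ih (m - w) (by omega) (by push_cast at hN; omega) ?_).2 w (by omega) (by omega) (by omega)
      push_cast
      have : 0 ≤ η * w := mul_nonneg (by linarith) hw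
      linarith
    intro m hm hN hb
    refine ⟨hB m hm hN hb, key m hm hb ?_⟩
    intro m' h1 h2
    refine hB m' h1 (h2.trans hN) ?_
    have : (m':ℝ) ≤ m := by exact_mod_cast h2
    have : η * m' ≤ η * m := mul_le_mul_of_nonneg_left this (by linarith)
    linarith

lemma goodB {x η ε : ℝ} (P : Par x η ε) (m u : ℤ) (hm : 0 ≤ m) (hb : η * m < 2/3 + ε)
    (h0 : 0 ≤ u) (h1 : u ≤ 1) (h2 : m = 0 → u = 0) : TB x η ε m u :=
  (good P m.toNat m hm (by omega) hb).1 u h0 h1 h2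

lemma goodA {x η ε : ℝ} (P : Par x η ε) (m u : ℤ) (hm : 0 ≤ m) (hb : η * m < 2/3 + ε)
    (h0 : 0 ≤ u) (h1 : u ≤ 2) (h2 : u = 2 → 2 ≤ m) : TA x η ε m u :=
  (good P m.toNat m hm (by omega) hb).2 u h0 h1 h2

/-- The set of witnesses. -/
def VV (x η : ℝ) (z : ℤ × ℤ) : Prop :=
  -2 ≤ z.1 + z.2 ∧ z.1 + z.2 ≤ 2 ∧ η * z.2 - η < x ∧ -(η * z.2) - η < x ∧
  (z.1 + z.2 = 2 → η * z.2 - 2 * η < 2 * x - 1) ∧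
  (z.1 + z.2 = -2 → -(η * z.2) - 2 * η < 2 * x - 1)

lemma VV_step {x η ε : ℝ} (P : Par x η ε) {p q c : ℤ} (h : VV x η (p, q))
    (h1 : (c:ℝ) + (x * p + (x + 1 - η) * q) < 1) (h2 : -1 < (c:ℝ) + (x * p + (x + 1 - η) * q)) :
    VV x η (q, c) := by
  obtain ⟨e0, e1, h0, h1', x0, x1⟩ := P
  obtain ⟨a1, a2, a3, a4, a5, a6⟩ := h
  simp only at a1 a2 a3 a4 a5 a6
  obtain ⟨s, rfl⟩ : ∃ s, p = s - q := ⟨p + q, by ring⟩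
  obtain ⟨t, rfl⟩ : ∃ t, c = t - q := ⟨c + q, by ring⟩
  simp only [sub_add_cancel] at a1 a2 a5 a6
  push_cast at h1 h2
  have k1 : (t:ℝ) + x * s - η * q < 1 := by linarith
  have k2 : -1 < (t:ℝ) + x * s - η * q := by linarith
  have b1 : (-2:ℝ) ≤ s := by exact_mod_cast a1
  have b2 : (s:ℝ) ≤ 2 := by exact_mod_cast a2
  have c1 : x * (-2) ≤ x * s := mul_le_mul_of_nonneg_left b1 (by linarith)
  have c2 : x * s ≤ x * 2 := mul_le_mul_of_nonneg_left b2 (by linarith)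
  have t1 : -3 < t := lt_of_real (by push_cast; linarith)
  have t2 : t < 3 := lt_of_real (by push_cast; linarith)
  clear h1 h2 b1 b2 c1 c2
  simp only [VV, add_sub_cancel]
  push_cast
  rw [mul_sub]
  refine ⟨by omega, by omega, ?_⟩
  have hs : s = -2 ∨ s = -1 ∨ s = 0 ∨ s = 1 ∨ s = 2 := by omega
  have ht : t = -2 ∨ t = -1 ∨ t = 0 ∨ t = 1 ∨ t = 2 := by omega
  rcases hs with rfl | rfl | rfl | rfl | rfl <;>
  rcases ht with rfl | rfl | rfl | rfl | rfl <;>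
  norm_num at k1 k2 a5 a6 ⊢ <;> refine ⟨?_, ?_⟩ <;> (try constructor) <;> linarith

lemma tau_VV {x η ε : ℝ} (P : Par x η ε) {z w : ℤ × ℤ} (h : VV x η w) :
    VV x η (tau2 (x, x + 1 - η) ε (z + w) - tau2 (x, x + 1 - η) ε z) := by
  obtain ⟨p, q⟩ := w
  obtain ⟨a, b⟩ := z
  simp only [tau2, Prod.mk_add_mk, Prod.mk_sub_mk, add_sub_cancel_left]
  apply VV_step P h
  · have h1 := Int.lt_floor_add_one (x * ((a + p : ℤ):ℝ) + (x + 1 - η) * ((b + q : ℤ):ℝ) + ε)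
    have h2 := Int.floor_le (x * (a:ℝ) + (x + 1 - η) * (b:ℝ) + ε)
    push_cast at h1 ⊢
    linarith
  · have h1 := Int.floor_le (x * ((a + p : ℤ):ℝ) + (x + 1 - η) * ((b + q : ℤ):ℝ) + ε)
    have h2 := Int.lt_floor_add_one (x * (a:ℝ) + (x + 1 - η) * (b:ℝ) + ε)
    push_cast at h1 ⊢
    linarith

lemma tau_zero {x η ε : ℝ} (P : Par x η ε) : tau2 (x, x + 1 - η) ε 0 = 0 := by
  have : ⌊ε⌋ = 0 := by
    rw [Int.floor_eq_iff]; push_cast; constructor <;> linarith [P.e0, P.e1]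
  simp [tau2, this]

lemma iter_VV {x η ε : ℝ} (P : Par x η ε) (z w : ℤ × ℤ) (h : VV x η w) (k : ℕ) :
    VV x η ((tau2 (x, x + 1 - η) ε)^[k] (z + w) - (tau2 (x, x + 1 - η) ε)^[k] z) := by
  induction k generalizing z w with
  | zero => simpa using h
  | succ k ih =>
    rw [Function.iterate_succ_apply, Function.iterate_succ_apply]
    have := ih (tau2 (x, x + 1 - η) ε z) _ (tau_VV P (z := z) h)
    rwa [add_sub_cancel] at this

lemma VA {x η : ℝ} {m u : ℤ} : VV x η (u + m, -m) ↔ VV x η (-u - m, m) := by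
  simp only [VV]
  push_cast
  have e1 : u + m + -m = u := by ring
  have e2 : -u - m + m = -u := by ring
  rw [e1, e2, mul_neg, neg_neg]
  constructor
  · rintro ⟨a1, a2, a3, a4, a5, a6⟩
    exact ⟨by omega, by omega, a4, a3, fun h => a6 (by omega), fun h => a5 (by omega)⟩
  · rintro ⟨a1, a2, a3, a4, a5, a6⟩
    exact ⟨by omega, by omega, a4, a3, fun h => a6 (by omega), fun h => a5 (by omega)⟩

/-- Witness set in (m,u) form. -/
def WW (x η : ℝ) (m u : ℤ) : Prop := VV x η (-u - m, m)

lemma WW_neg {x η : ℝ} {m u : ℤ} (h : WW x η (-m) (-u)) : WW x η m u := by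
  unfold WW at *
  rw [← VA]
  rwa [neg_neg, sub_neg_eq_add] at h

lemma WW_bd {x η ε : ℝ} (P : Par x η ε) {m u : ℤ} (h : WW x η m u) :
    η * m < 2/3 + ε ∧ -2 ≤ u ∧ u ≤ 2 := by
  obtain ⟨a1, a2, a3, a4, a5, a6⟩ := h
  simp only at a1 a2 a3
  refine ⟨by linarith [P.h1, P.x1, P.e0], by omega, by omega⟩

lemma stepAW {x η ε : ℝ} (P : Par x η ε) {m u : ℤ} (hW : WW x η m u)
    (h : ∀ w : ℤ, (w:ℝ) ≤ x * u + η * m + ε → x * u + η * m + ε < w + 1 →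
      WW x η (m - w) w → TB x η ε (m - w) w) :
    TA x η ε m u := by
  apply stepA'
  intro w w1 w2
  refine h w w1 w2 ?_
  unfold WW at *
  rw [← VA] at hW
  have e : -w - (m - w) = -m := by ring
  rw [e]
  apply VV_step P hW
  · push_cast; linarith [P.e0]
  · push_cast; linarith [P.e1]

lemma stepBW {x η ε : ℝ} (P : Par x η ε) {m u : ℤ} (hW : WW x η m u)
    (h : ∀ w : ℤ, x * u + η * m - ε ≤ w → (w:ℝ) - 1 < x * u + η * m - ε →
      WW x η (m - w) w → TA x η ε (m - w) w) :
    TB x η ε m u := by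
  apply stepB'
  intro w w1 w2
  refine h w w1 w2 ?_
  unfold WW at *
  rw [← VA]
  have e : w + (m - w) = m := by ring
  rw [e]
  apply VV_step P hW
  · push_cast; linarith [P.e0]
  · push_cast; linarith [P.e0, P.e1]

lemma L1 {x η ε : ℝ} (P : Par x η ε) {m : ℤ} (hm : 0 ≤ m) (hW : WW x η m (-1)) :
    TB x η ε m (-1) := by
  obtain ⟨e0, e1, h0, h1, x0, x1⟩ := id P
  have hb := (WW_bd P hW).1
  have hm' : (0:ℝ) ≤ m := by exact_mod_cast hm
  have hem : 0 ≤ η * m := mul_nonneg (by linarith) hm'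
  apply stepBW P hW
  intro w w1 w2 hw
  push_cast at w1 w2
  have a1 : -1 < w := lt_of_real (by push_cast; linarith)
  have a2 : w < 2 := lt_of_real (by push_cast; linarith)
  have a3 : m = 0 → w < 1 := by
    rintro rfl
    apply lt_of_real; push_cast at *; linarith
  exact goodA P _ _ (by omega) (WW_bd P hw).1 (by omega) (by omega) (by omega)

lemma L2 {x η ε : ℝ} (P : Par x η ε) {m : ℤ} (hm : 0 ≤ m) (hW : WW x η m (-1)) :
    TA x η ε m (-1) := by
  obtain ⟨e0, e1, h0, h1, x0, x1⟩ := id P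
  have hb := (WW_bd P hW).1
  have hm' : (0:ℝ) ≤ m := by exact_mod_cast hm
  have hem : 0 ≤ η * m := mul_nonneg (by linarith) hm'
  apply stepAW P hW
  intro w w1 w2 hw
  push_cast at w1 w2
  have a1 : -2 < w := lt_of_real (by push_cast; linarith)
  have a2 : w < 1 := lt_of_real (by push_cast; linarith)
  obtain rfl | rfl : w = -1 ∨ w = 0 := by omega
  · exact L1 P (by omega) hw
  · exact goodB P _ _ (by omega) (WW_bd P hw).1 (by omega) (by omega) (by omega)

lemma L3 {x η ε : ℝ} (P : Par x η ε) {m : ℤ} (hm : 0 ≤ m) (hW : WW x η m (-2)) :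
    TB x η ε m (-2) := by
  obtain ⟨e0, e1, h0, h1, x0, x1⟩ := id P
  have hb := (WW_bd P hW).1
  have hm' : (0:ℝ) ≤ m := by exact_mod_cast hm
  have hem : 0 ≤ η * m := mul_nonneg (by linarith) hm'
  apply stepBW P hW
  intro w w1 w2 hw
  push_cast at w1 w2
  have a1 : -2 < w := lt_of_real (by push_cast; linarith)
  have a2 : w < 2 := lt_of_real (by push_cast; linarith)
  have a3 : m = 0 → w < 1 := by
    rintro rfl
    apply lt_of_real; push_cast at *; linarith
  obtain rfl | hw0 : w = -1 ∨ 0 ≤ w := by omega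
  · exact L2 P (by omega) hw
  · exact goodA P _ _ (by omega) (WW_bd P hw).1 (by omega) (by omega) (by omega)

lemma L4 {x η ε : ℝ} (P : Par x η ε) {m : ℤ} (hm : 0 ≤ m) (hW : WW x η m (-2)) :
    TA x η ε m (-2) := by
  obtain ⟨e0, e1, h0, h1, x0, x1⟩ := id P
  have hb := (WW_bd P hW).1
  have hm' : (0:ℝ) ≤ m := by exact_mod_cast hm
  have hem : 0 ≤ η * m := mul_nonneg (by linarith) hm'
  apply stepAW P hW
  intro w w1 w2 hw
  push_cast at w1 w2
  have a1 : -3 < w := lt_of_real (by push_cast; linarith)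
  have a2 : w < 1 := lt_of_real (by push_cast; linarith)
  obtain rfl | rfl | rfl : w = -2 ∨ w = -1 ∨ w = 0 := by omega
  · exact L3 P (by omega) hw
  · exact L1 P (by omega) hw
  · exact goodB P _ _ (by omega) (WW_bd P hw).1 (by omega) (by omega) (by omega)

lemma L5 {x η ε : ℝ} (P : Par x η ε) {m : ℤ} (hm : 0 ≤ m) (hW : WW x η m 1) :
    TB x η ε m 1 := by
  obtain ⟨e0, e1, h0, h1, x0, x1⟩ := id P
  by_cases h : 1 ≤ m
  · exact goodB P _ _ (by omega) (WW_bd P hW).1 (by omega) (by omega) (by omega)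
  obtain rfl : m = 0 := by omega
  apply stepBW P hW
  intro w w1 w2 hw
  push_cast at w1 w2
  have a1 : 0 < w := lt_of_real (by push_cast; linarith)
  have a2 : w < 2 := lt_of_real (by push_cast; linarith)
  obtain rfl : w = 1 := by omega
  exact negAB.2 (L1 P (m := 1) (by omega) (WW_neg hw))

lemma L6 {x η ε : ℝ} (P : Par x η ε) {m : ℤ} (hm : 0 ≤ m) (hW : WW x η m 2) :
    TA x η ε m 2 := by
  obtain ⟨e0, e1, h0, h1, x0, x1⟩ := id P
  by_cases h : 2 ≤ m
  · exact goodA P _ _ (by omega) (WW_bd P hW).1 (by omega) (by omega) (by omega)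
  have hm1 : (m:ℝ) ≤ 1 := by exact_mod_cast (by omega : m ≤ 1)
  have hm' : (0:ℝ) ≤ m := by exact_mod_cast hm
  have hem : 0 ≤ η * m := mul_nonneg (by linarith) hm'
  have hem1 : η * m ≤ η * 1 := mul_le_mul_of_nonneg_left hm1 (by linarith)
  apply stepAW P hW
  intro w w1 w2 hw
  push_cast at w1 w2
  have a1 : -1 < w := lt_of_real (by push_cast; linarith)
  have a2 : w < 2 := lt_of_real (by push_cast; linarith)
  obtain rfl | rfl : w = 0 ∨ w = 1 := by omega
  · exact goodB P _ _ (by omega) (WW_bd P hw).1 (by omega) (by omega) (by omega)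
  · obtain rfl | rfl : m = 0 ∨ m = 1 := by omega
    · exact negAB.1 (L2 P (m := 1) (by omega) (WW_neg hw))
    · exact L5 P (by omega) hw

lemma L7 {x η ε : ℝ} (P : Par x η ε) {m : ℤ} (hm : 0 ≤ m) (hW : WW x η m 2) :
    TB x η ε m 2 := by
  obtain ⟨e0, e1, h0, h1, x0, x1⟩ := id P
  have hm' : (0:ℝ) ≤ m := by exact_mod_cast hm
  have hem : 0 ≤ η * m := mul_nonneg (by linarith) hm'
  apply stepBW P hW
  intro w w1 w2 hw
  have hb := WW_bd P hw
  push_cast at w1 w2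
  have a1 : -1 < w := lt_of_real (by push_cast; linarith)
  by_cases h : 0 ≤ m - w
  · obtain h2 | rfl : w ≤ 1 ∨ w = 2 := by omega
    · exact goodA P _ _ (by omega) (WW_bd P hw).1 (by omega) (by omega) (by omega)
    · exact L6 P h hw
  · obtain ⟨rfl, rfl⟩ | ⟨rfl, rfl⟩ | ⟨rfl, rfl⟩ :
      (m = 0 ∧ w = 1) ∨ (m = 0 ∧ w = 2) ∨ (m = 1 ∧ w = 2) := by omega
    · exact negAB.2 (L1 P (m := 1) (by omega) (WW_neg hw))
    · exact negAB.2 (L3 P (m := 2) (by omega) (WW_neg hw))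
    · exact negAB.2 (L3 P (m := 1) (by omega) (WW_neg hw))

lemma LA {x η ε : ℝ} (P : Par x η ε) {m u : ℤ} (hm : 0 ≤ m) (hW : WW x η m u) :
    TA x η ε m u := by
  have hb := WW_bd P hW
  obtain rfl | rfl | h | rfl : u = -2 ∨ u = -1 ∨ (0 ≤ u ∧ u ≤ 1) ∨ u = 2 := by omega
  · exact L4 P hm hW
  · exact L2 P hm hW
  · exact goodA P _ _ (by omega) hb.1 (by omega) (by omega) (by omega)
  · exact L6 P hm hW

lemma LB {x η ε : ℝ} (P : Par x η ε) {m u : ℤ} (hm : 0 ≤ m) (hW : WW x η m u) :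
    TB x η ε m u := by
  have hb := WW_bd P hW
  obtain rfl | rfl | rfl | rfl | rfl : u = -2 ∨ u = -1 ∨ u = 0 ∨ u = 1 ∨ u = 2 := by omega
  · exact L3 P hm hW
  · exact L1 P hm hW
  · exact goodB P _ _ (by omega) hb.1 (by omega) (by omega) (by omega)
  · exact L5 P hm hW
  · exact L7 P hm hW

lemma VV_rch {x η ε : ℝ} (P : Par x η ε) {z : ℤ × ℤ} (h : VV x η z) : Rch x η ε z := by
  obtain ⟨p, q⟩ := z
  have h' : WW x η q (-p - q) := by
    unfold WW
    have : -(-p - q) - q = p := by ring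
    rwa [this]
  have key : TB x η ε q (-p - q) := by
    by_cases hq : 0 ≤ q
    · exact LB P hq h'
    · rw [← negAB]
      exact LA P (by omega) (WW_neg (by rwa [neg_neg, neg_neg]))
  unfold TB at key
  have : -(-p - q) - q = p := by ring
  rwa [this] at key

lemma rch_add {x η ε : ℝ} (P : Par x η ε) {z w : ℤ × ℤ} (hz : Rch x η ε z) (h : VV x η w) :
    Rch x η ε (z + w) := by
  obtain ⟨k, hk⟩ := hz
  have h1 := iter_VV P z w h k
  rw [hk] at h1
  have h2 : VV x η ((tau2 (x, x + 1 - η) ε)^[k] (z + w)) := by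
    rwa [show ((0, 0) : ℤ × ℤ) = 0 from rfl, sub_zero] at h1
  obtain ⟨j, hj⟩ := VV_rch P h2
  exact ⟨j + k, by rw [Function.iterate_add_apply]; exact hj⟩

lemma rch_all {x η ε : ℝ} (P : Par x η ε) (z : ℤ × ℤ) : Rch x η ε z := by
  obtain ⟨e0, e1, h0, h1, x0, x1⟩ := id P
  have v1 : VV x η (1, 0) := by
    simp only [VV]; norm_num; (try constructor) <;> linarith
  have v2 : VV x η (-1, 0) := by
    simp only [VV]; norm_num; (try constructor) <;> linarith
  have v3 : VV x η (0, 1) := by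
    simp only [VV]; norm_num; (try constructor) <;> linarith
  have v4 : VV x η (0, -1) := by
    simp only [VV]; norm_num; (try constructor) <;> linarith
  have A : ∀ p : ℤ, Rch x η ε (p, 0) := by
    intro p
    induction p using Int.induction_on with
    | zero => exact ⟨0, rfl⟩
    | succ i ih => simpa using rch_add P ih v1
    | pred i ih => simpa [sub_eq_add_neg] using rch_add P ih v2
  obtain ⟨p, q⟩ := z
  induction q using Int.induction_on with
  | zero => exact A p
  | succ i ih => simpa using rch_add P ih v3
  | pred i ih => simpa [sub_eq_add_neg] using rch_add P ih v4

lemma not_srs {x ε : ℝ} (e0 : 0 < ε) (e1 : ε < 2/21) : (x, x + 1 - ε) ∉ SRS2 ε := by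
  intro h
  obtain ⟨k, hk⟩ := h (-1, 1)
  have s1 : tau2 (x, x + 1 - ε) ε (-1, 1) = (1, -1) := by
    have : ⌊x * ((-1:ℤ):ℝ) + (x + 1 - ε) * ((1:ℤ):ℝ) + ε⌋ = 1 := by
      rw [Int.floor_eq_iff]; push_cast; constructor <;> linarith
    simp only [tau2, this]
  have s2 : tau2 (x, x + 1 - ε) ε (1, -1) = (-1, 1) := by
    have : ⌊x * ((1:ℤ):ℝ) + (x + 1 - ε) * ((-1:ℤ):ℝ) + ε⌋ = -1 := by
      rw [Int.floor_eq_iff]; push_cast; constructor <;> linarith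
    simp only [tau2, this]; rfl
  have : ∀ k : ℕ, (tau2 (x, x + 1 - ε) ε)^[k] (-1, 1) = (-1, 1) ∨
      (tau2 (x, x + 1 - ε) ε)^[k] (-1, 1) = (1, -1) := by
    intro k
    induction k with
    | zero => left; rfl
    | succ k ih =>
      rw [Function.iterate_succ_apply']
      rcases ih with h | h <;> rw [h]
      · right; exact s1
      · left; exact s2
  rcases this k with h | h <;> rw [h] at hk <;> simp at hk

theorem stmt_18 (n : ℕ) (hn : 4 ≤ n) (ε : ℝ)
    (hε0 : 2 / (3 * (2 * (n : ℝ) + 1)) ≤ ε)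
    (hε1 : ε < 2 / (3 * (2 * (n : ℝ) - 1))) :
    convexHull ℝ ({(ε, 1), (2/3 - ε, 5/3 - 2*ε),
        (2/3 - ε, 5/3 - 2*ε - 2*ε / (n : ℝ))} : Set (ℝ × ℝ)) ∩ SRS2 ε =
      convexHull ℝ ({(ε, 1), (2/3 - ε, 5/3 - 2*ε),
        (2/3 - ε, 5/3 - 2*ε - 2*ε / (n : ℝ))} : Set (ℝ × ℝ)) \
        segment ℝ ((ε, 1) : ℝ × ℝ) ((2/3 - ε, 5/3 - 2*ε) : ℝ × ℝ) := by
  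
  have hn' : (4:ℝ) ≤ n := by exact_mod_cast hn
  have e0 : 0 < ε := lt_of_lt_of_le (by positivity) hε0
  have e1 : ε < 2/21 := by
    refine hε1.trans_le ?_
    rw [div_le_div_iff₀ (by linarith) (by norm_num)]
    linarith
  ext r
  simp only [Set.mem_inter_iff, Set.mem_sdiff]
  refine and_congr_right fun hr => ⟨?_, ?_⟩
  · rintro hs ⟨a, b, ha, hb, hab, rfl⟩
    apply not_srs (x := a * ε + b * (2/3 - ε)) e0 e1
    convert hs using 1
    simp only [Prod.smul_mk, smul_eq_mul, Prod.mk_add_mk, Prod.mk.injEq, true_and]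
    have : b = 1 - a := by linarith
    subst this; ring
  · intro hs
    rw [convexHull_insert (by simp), convexHull_pair, convexJoin_singleton_left] at hr
    simp only [Set.mem_iUnion] at hr
    obtain ⟨p, ⟨c, d, hc, hd, hcd, rfl⟩, a, b, ha, hb, hab, rfl⟩ := hr
    have hc' : c = 1 - d := by linarith
    have ha' : a = 1 - b := by linarith
    have hbd : 0 < b * d := by
      rcases (mul_nonneg hb hd).lt_or_eq with h | h
      · exact h
      exfalso
      apply hs
      refine ⟨a, b, ha, hb, hab, ?_⟩
      simp only [Prod.smul_mk, smul_eq_mul, Prod.mk_add_mk, Prod.mk.injEq]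
      subst hc'
      refine ⟨by ring, ?_⟩
      linear_combination (-2 * ε / n) * h
    have hb0 : 0 < b := lt_of_le_of_ne hb (by rintro rfl; simp at hbd)
    have hbd1 : b * d ≤ 1 := mul_le_one₀ (by linarith) hd (by linarith)
    have hen : 2 * ε / n ≤ ε / 2 := by
      rw [div_le_div_iff₀ (by linarith) (by norm_num)]; nlinarith
    have hen0 : 0 < 2 * ε / n := by positivity
    have P : Par (a * ε + b * (2/3 - ε)) (ε + b * d * (2 * ε / n)) ε := by
      refine ⟨e0, e1, ?_, ?_, ?_, ?_⟩
      · have := mul_pos hbd hen0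
        linarith
      · have := mul_le_mul_of_nonneg_right hbd1 hen0.le
        linarith
      · subst ha'; nlinarith
      · subst ha'; nlinarith
    intro z
    have := rch_all P z
    unfold Rch at this
    convert this using 5
    simp only [Prod.smul_mk, smul_eq_mul, Prod.mk_add_mk, Prod.mk.injEq]
    subst ha' hc'
    constructor <;> ring
end

section
/- Let n ≥ 4 be an integer, ε ∈ [2/(3(2n+1)), 2/(3(2n-1))), and l = ⌊(2n² - 3n)/4⌋ + 1. For k = 2,…,l set V_k = (2/3-ε, 5/3-2ε-kε/n), and let W = (ε, 1). Then for every s with 2 ≤ s ≤ l-1, the closed triangle Δ with vertices W, V_s, V_{s+1} satisfies Δ ∩ D⁰_{2,ε} = Δ \ {W}. -/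
/-- The finite witness set (Brunotte), in coordinates `a = z₂`, `d = z₁ + z₂`. -/
def WV (x η M : ℝ) (a d : ℤ) : Prop :=
  (d = 0 ∧ -(M + η) < η * a ∧ η * a < M + η) ∨
  (d = 1 ∧ -M < η * a ∧ η * a < M + η) ∨
  (d = -1 ∧ -(M + η) < η * a ∧ η * a < M) ∨
  (d = 2 ∧ -(M - 2 * η) < η * a ∧ η * a < 2 * x - 1 + 2 * η) ∨
  (d = -2 ∧ -(2 * x - 1 + 2 * η) < η * a ∧ η * a < M - 2 * η)

theorem WV.neg {x η M : ℝ} {a d : ℤ} (h : WV x η M a d) : WV x η M (-a) (-d) := by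
  unfold WV at *
  rcases h with ⟨rfl, h1, h2⟩ | ⟨rfl, h1, h2⟩ | ⟨rfl, h1, h2⟩ | ⟨rfl, h1, h2⟩ | ⟨rfl, h1, h2⟩
  · left; refine ⟨rfl, ?_, ?_⟩ <;> push_cast <;> linarith
  · right; right; left; refine ⟨rfl, ?_, ?_⟩ <;> push_cast <;> linarith
  · right; left; refine ⟨rfl, ?_, ?_⟩ <;> push_cast <;> linarith
  · right; right; right; right; refine ⟨rfl, ?_, ?_⟩ <;> push_cast <;> linarith
  · right; right; right; left; refine ⟨rfl, ?_, ?_⟩ <;> push_cast <;> linarith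

theorem WV.closed_nonneg {x η M ε : ℝ} (he : 0 < ε) (h1 : ε < η) (h2 : η ≤ x)
    (h3 : x ≤ 2 / 3 - ε) (h5 : 3 * η < 2 / 3 + ε) (hM1 : x ≤ M)
    (hM2 : 2 * x - 1 + 2 * η ≤ M) (hM3 : M + η + ε < 1) (hM4 : 2 * x + M - 2 * η + ε < 2)
    (he2 : ε ≤ 2 / 21)
    {a d : ℤ} (hd : 0 ≤ d) (h : WV x η M a d) (m : ℤ) (hm1 : x * d - η * a - 1 < m)
    (hm2 : (m : ℝ) < x * d - η * a + 1) : WV x η M (a + m) m := by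
  unfold WV at h
  rcases h with ⟨rfl, g1, g2⟩ | ⟨rfl, g1, g2⟩ | ⟨rfl, g1, g2⟩ | ⟨rfl, g1, g2⟩ | ⟨rfl, g1, g2⟩
  · have l1 : -2 < m := by
      have : ((-2 : ℤ) : ℝ) < m := by push_cast at *; linarith
      exact_mod_cast this
    have l2 : m < 2 := by
      have : (m : ℝ) < (2 : ℤ) := by push_cast at *; linarith
      exact_mod_cast this
    interval_cases m
    · right; right; left; refine ⟨rfl, ?_, ?_⟩ <;> push_cast at * <;> linarith
    · left; refine ⟨rfl, ?_, ?_⟩ <;> push_cast at * <;> linarith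
    · right; left; refine ⟨rfl, ?_, ?_⟩ <;> push_cast at * <;> linarith
  · have l1 : -2 < m := by
      have : ((-2 : ℤ) : ℝ) < m := by push_cast at *; linarith
      exact_mod_cast this
    have l2 : m < 3 := by
      have : (m : ℝ) < (3 : ℤ) := by push_cast at *; linarith
      exact_mod_cast this
    interval_cases m
    · right; right; left; refine ⟨rfl, ?_, ?_⟩ <;> push_cast at * <;> linarith
    · left; refine ⟨rfl, ?_, ?_⟩ <;> push_cast at * <;> linarith
    · right; left; refine ⟨rfl, ?_, ?_⟩ <;> push_cast at * <;> linarith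
    · right; right; right; left; refine ⟨rfl, ?_, ?_⟩ <;> push_cast at * <;> linarith
  · omega
  · have l1 : -1 < m := by
      have : ((-1 : ℤ) : ℝ) < m := by push_cast at *; linarith
      exact_mod_cast this
    have l2 : m < 3 := by
      have : (m : ℝ) < (3 : ℤ) := by push_cast at *; linarith
      exact_mod_cast this
    interval_cases m
    · left; refine ⟨rfl, ?_, ?_⟩ <;> push_cast at * <;> linarith
    · right; left; refine ⟨rfl, ?_, ?_⟩ <;> push_cast at * <;> linarith
    · right; right; right; left; refine ⟨rfl, ?_, ?_⟩ <;> push_cast at * <;> linarith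
  · omega

theorem WV.closed {x η M ε : ℝ} (he : 0 < ε) (h1 : ε < η) (h2 : η ≤ x)
    (h3 : x ≤ 2 / 3 - ε) (h5 : 3 * η < 2 / 3 + ε) (hM1 : x ≤ M)
    (hM2 : 2 * x - 1 + 2 * η ≤ M) (hM3 : M + η + ε < 1) (hM4 : 2 * x + M - 2 * η + ε < 2)
    (he2 : ε ≤ 2 / 21)
    {a d : ℤ} (h : WV x η M a d) (m : ℤ) (hm1 : x * d - η * a - 1 < m)
    (hm2 : (m : ℝ) < x * d - η * a + 1) : WV x η M (a + m) m := by
  rcases le_total 0 d with hd | hd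
  · exact WV.closed_nonneg he h1 h2 h3 h5 hM1 hM2 hM3 hM4 he2 hd h m hm1 hm2
  · have := WV.closed_nonneg he h1 h2 h3 h5 hM1 hM2 hM3 hM4 he2 (by omega : 0 ≤ -d) h.neg (-m)
      (by push_cast; linarith) (by push_cast; linarith)
    have := this.neg
    rwa [show -(-a + -m) = a + m by ring, neg_neg] at this

/-- Orbits of all witnesses reach zero. `F` = next step rounds down, `C` = next step rounds up. -/
theorem wit_reach {x η M ε : ℝ} (he : 0 < ε) (h1 : ε < η) (h2 : η ≤ x)
    (h3 : x ≤ 2 / 3 - ε) (h4 : η < 1 / 6 + ε) (h5 : 3 * η < 2 / 3 + ε) (hM1 : x ≤ M)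
    (hM2 : 2 * x - 1 + 2 * η ≤ M) (hM3 : M + η + ε < 1) (hM4 : 2 * x + M - 2 * η + ε < 2)
    (he2 : ε ≤ 2 / 21)
    (F C : ℤ → ℤ → Prop) (h00 : F 0 0) (hsym : ∀ a d, F a d ↔ C (-a) (-d))
    (hF : ∀ a d m : ℤ, (m : ℝ) ≤ x * d - η * a + ε → x * d - η * a + ε < m + 1 →
      C (a + m) m → F a d)
    (hC : ∀ a d m : ℤ, (m : ℝ) - 1 < x * d - η * a - ε → x * d - η * a - ε ≤ m →
      F (a + m) m → C a d) :
    ∀ a d : ℤ, WV x η M a d → F a d := by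
  have hη : 0 < η := by linarith
  -- integrality
  have int_lt : ∀ (a b : ℤ), η * b < η * a → b < a := by
    intro a b h
    have : (b : ℝ) < a := lt_of_mul_lt_mul_left h hη.le
    exact_mod_cast this
  have le_int : ∀ (a b : ℤ), b ≤ a → η * b ≤ η * a := by
    intro a b h
    exact mul_le_mul_of_nonneg_left (by exact_mod_cast h) hη.le
  have c00 : C 0 0 := by simpa using (hsym 0 0).1 h00
  -- positive descent
  have PD : ∀ N : ℕ, ∀ a : ℤ, a + 1 < N →
      ((0 ≤ a → η * a < M + η → C a 0) ∧ (-1 ≤ a → η * a < M + η → C a (-1)) ∧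
       (1 ≤ a → η * a < M - 2 * η → C a (-2))) := by
    intro N
    induction N with
    | zero =>
      intro a ha
      push_cast at ha
      exact ⟨fun h => by omega, fun h => by omega, fun h => by omega⟩
    | succ N ih =>
      intro a ha
      push_cast at ha
      -- F a 0 from smaller
      have F0 : ∀ b : ℤ, 0 ≤ b → b ≤ a → η * b < M + η → F b 0 := by
        intro b hb hba hbM
        rcases hb.eq_or_lt with rfl | hb
        · exact h00
        have := le_int b 1 (by omega)
        have := (ih (b - 1) (by omega)).2.1 (by omega) (by push_cast at *; linarith)
        refine hF b 0 (-1) ?_ ?_ (by simpa [sub_eq_add_neg] using this) <;>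
          push_cast at * <;> linarith
      have F1 : ∀ b : ℤ, 0 ≤ b → b < a → η * b < M → F b (-1) := by
        intro b hb hba hbM
        have hb0 := le_int b 0 hb
        by_cases hc : x + η * b - ε ≤ 1
        · have := (ih (b - 1) (by omega)).2.1 (by omega) (by push_cast at *; linarith)
          refine hF b (-1) (-1) ?_ ?_ (by simpa [sub_eq_add_neg] using this) <;>
            push_cast at * <;> linarith
        · push Not at hc
          have : 2 < b := int_lt b 2 (by push_cast; linarith)
          have := (ih (b - 2) (by omega)).2.2 (by omega) (by push_cast at *; linarith)
          refine hF b (-1) (-2) ?_ ?_ (by simpa [sub_eq_add_neg] using this) <;>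
            push_cast at * <;> linarith
      refine ⟨fun ha0 haM => ?_, fun ha0 haM => ?_, fun ha0 haM => ?_⟩
      · have g := le_int a 0 ha0
        refine hC a 0 0 ?_ ?_ (by simpa using F0 a ha0 le_rfl haM) <;>
          push_cast at * <;> linarith
      · rcases ha0.eq_or_lt with rfl | ha1
        · have t1 : F 0 1 := by
            refine hF 0 1 0 ?_ ?_ (by simpa using c00) <;> push_cast <;> linarith
          have t2 : C (-1) 0 := by
            refine hC (-1) 0 1 ?_ ?_ (by simpa using t1) <;> push_cast <;> linarith
          have t3 : F (-1) 0 := by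
            refine hF (-1) 0 0 ?_ ?_ (by simpa using t2) <;> push_cast <;> linarith
          refine hC (-1) (-1) 0 ?_ ?_ (by simpa using t3) <;> push_cast <;> linarith
        · have g := le_int a 0 (by omega)
          by_cases hc : x + η * a + ε < 1
          · refine hC a (-1) 0 ?_ ?_ (by simpa using F0 a (by omega) le_rfl haM) <;>
              push_cast at * <;> linarith
          · push Not at hc
            have : 0 < a := int_lt a 0 (by push_cast; linarith)
            have := F1 (a - 1) (by omega) (by omega) (by push_cast; linarith)
            refine hC a (-1) (-1) ?_ ?_ (by simpa [sub_eq_add_neg] using this) <;>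
              push_cast at * <;> linarith
      · have g := le_int a 0 (by omega)
        by_cases hc : 2 * x + η * a + ε < 1
        · refine hC a (-2) 0 ?_ ?_ (by simpa using F0 a (by omega) le_rfl (by linarith)) <;>
            push_cast at * <;> linarith
        · push Not at hc
          have := F1 (a - 1) (by omega) (by omega) (by push_cast; linarith)
          refine hC a (-2) (-1) ?_ ?_ (by simpa [sub_eq_add_neg] using this) <;>
            push_cast at * <;> linarith
  have P0 : ∀ a : ℤ, 0 ≤ a → η * a < M + η → C a 0 := fun a ha h =>
    (PD (a + 2).toNat a (by omega)).1 ha h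
  have P1 : ∀ a : ℤ, -1 ≤ a → η * a < M + η → C a (-1) := fun a ha h =>
    (PD (a + 2).toNat a (by omega)).2.1 ha h
  have P2 : ∀ a : ℤ, 1 ≤ a → η * a < M - 2 * η → C a (-2) := fun a ha h =>
    (PD (a + 2).toNat a (by omega)).2.2 ha h
  have F0 : ∀ a : ℤ, -(M + η) < η * a → η * a < M + η → F a 0 := by
    intro a g1 g2
    rcases le_or_gt a 0 with ha | ha
    · rw [hsym]
      simpa using P0 (-a) (by omega) (by push_cast; linarith)
    · have := le_int a 1 (by omega)
      have := P1 (a - 1) (by omega) (by push_cast; linarith)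
      refine hF a 0 (-1) ?_ ?_ (by simpa [sub_eq_add_neg] using this) <;>
        push_cast at * <;> linarith
  have C0 : ∀ a : ℤ, -(M + η) < η * a → η * a < M + η → C a 0 := by
    intro a g1 g2
    have := (hsym (-a) 0).1 (F0 (-a) (by push_cast; linarith) (by push_cast; linarith))
    simpa using this
  have C1 : ∀ a : ℤ, -(M + η) < η * a → η * a < M + η → C a (-1) := by
    intro a g1 g2
    rcases le_or_gt (-1) a with ha | ha
    · exact P1 a ha g2
    · have g := le_int (-2) a (by omega)
      by_cases hc : -x - η * a - ε ≤ 0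
      · refine hC a (-1) 0 ?_ ?_ (by simpa using F0 a g1 g2) <;> push_cast at * <;> linarith
      · push Not at hc
        have t : F (a + 1) 1 := by
          rw [hsym]
          exact P1 _ (by omega) (by push_cast; linarith)
        refine hC a (-1) 1 ?_ ?_ t <;> push_cast at * <;> linarith
  have F1 : ∀ a : ℤ, -(M + η) < η * a → η * a < M → F a (-1) := by
    intro a g1 g2
    by_cases hc : 0 ≤ -x - η * a + ε
    · refine hF a (-1) 0 ?_ ?_ (by simpa using C0 a g1 (by linarith)) <;>
        push_cast at * <;> linarith
    · push Not at hc
      by_cases hc2 : x + η * a - ε ≤ 1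
      · have := C1 (a - 1) (by push_cast; linarith) (by push_cast; linarith)
        refine hF a (-1) (-1) ?_ ?_ (by simpa [sub_eq_add_neg] using this) <;>
          push_cast at * <;> linarith
      · push Not at hc2
        have : 2 < a := int_lt a 2 (by push_cast; linarith)
        have := P2 (a - 2) (by omega) (by push_cast; linarith)
        refine hF a (-1) (-2) ?_ ?_ (by simpa [sub_eq_add_neg] using this) <;>
          push_cast at * <;> linarith
  have C2 : ∀ a : ℤ, -(2 * x - 1 + 2 * η) < η * a → η * a < M - 2 * η → C a (-2) := by
    intro a g1 g2
    rcases le_or_gt 1 a with ha | ha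
    · exact P2 a ha g2
    · have g := le_int 0 a (by omega)
      by_cases hc : 2 * x + η * a + ε < 1
      · refine hC a (-2) 0 ?_ ?_ (by simpa using F0 a (by linarith) (by linarith)) <;>
          push_cast at * <;> linarith
      · push Not at hc
        have := F1 (a - 1) (by push_cast; linarith) (by push_cast; linarith)
        refine hC a (-2) (-1) ?_ ?_ (by simpa [sub_eq_add_neg] using this) <;>
          push_cast at * <;> linarith
  have F2 : ∀ a : ℤ, -(2 * x - 1 + 2 * η) < η * a → η * a < M - 2 * η → F a (-2) := by
    intro a g1 g2
    by_cases hc : 2 * x + η * a - ε ≤ 1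
    · have := C1 (a - 1) (by push_cast; linarith) (by push_cast; linarith)
      refine hF a (-2) (-1) ?_ ?_ (by simpa [sub_eq_add_neg] using this) <;>
        push_cast at * <;> linarith
    · push Not at hc
      have := C2 (a - 2) (by push_cast; linarith) (by push_cast; linarith)
      refine hF a (-2) (-2) ?_ ?_ (by simpa [sub_eq_add_neg] using this) <;>
        push_cast at * <;> linarith
  intro a d h
  rcases h with ⟨rfl, g1, g2⟩ | ⟨rfl, g1, g2⟩ | ⟨rfl, g1, g2⟩ | ⟨rfl, g1, g2⟩ | ⟨rfl, g1, g2⟩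
  · exact F0 a g1 g2
  · rw [hsym]; exact C1 _ (by push_cast; linarith) (by push_cast; linarith)
  · exact F1 a g1 g2
  · rw [hsym]; exact C2 _ (by push_cast; linarith) (by push_cast; linarith)
  · exact F2 a g1 g2

theorem mem_SRS2_of {x η M ε : ℝ} (he : 0 < ε) (h1 : ε < η) (h2 : η ≤ x)
    (h3 : x ≤ 2 / 3 - ε) (h4 : η < 1 / 6 + ε) (h5 : 3 * η < 2 / 3 + ε) (hM1 : x ≤ M)
    (hM2 : 2 * x - 1 + 2 * η ≤ M) (hM3 : M + η + ε < 1) (hM4 : 2 * x + M - 2 * η + ε < 2)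
    (he2 : ε ≤ 2 / 21) : ((x, 1 + x - η) : ℝ × ℝ) ∈ SRS2 ε := by
  set r : ℝ × ℝ := (x, 1 + x - η) with hr
  let G : ℤ × ℤ → Prop := fun z => ∃ k : ℕ, (tau2 r ε)^[k] z = (0, 0)
  have G0 : G (0, 0) := ⟨0, rfl⟩
  have Gstep : ∀ z, G (tau2 r ε z) → G z := by
    rintro z ⟨k, hk⟩
    exact ⟨k + 1, by rwa [Function.iterate_succ_apply]⟩
  have key : ∀ a d m : ℤ, (m : ℝ) ≤ x * d - η * a + ε → x * d - η * a + ε < m + 1 →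
      tau2 r ε (d - a, a) = (a, -(a + m)) := by
    intro a d m g1 g2
    simp only [tau2, hr, Prod.mk.injEq, neg_inj, true_and]
    rw [Int.floor_eq_iff]
    push_cast
    constructor <;> linarith
  have wit : ∀ z : ℤ × ℤ, WV x η M z.2 (z.1 + z.2) → G z := by
    have := wit_reach he h1 h2 h3 h4 h5 hM1 hM2 hM3 hM4 he2
      (fun a d => G (d - a, a)) (fun a d => G (-d + a, -a)) (by simpa using G0)
      (by
        intro a d
        have e1 : d - a = - -d + -a := by ring
        have e2 : a = - -a := by ring
        show G (d - a, a) ↔ G (- -d + -a, - -a)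
        rw [← e1, ← e2])
      (by
        intro a d m g1 g2 h
        apply Gstep
        rw [key a d m g1 g2]
        convert h using 2
        ring)
      (by
        intro a d m g1 g2 h
        apply Gstep
        have := key (-a) (-d) (-m) (by push_cast; linarith) (by push_cast; linarith)
        rw [show -d + a = -d - -a by ring, this]
        convert h using 2 <;> ring)
    intro z hz
    have := this _ _ hz
    simpa using this
  have clos : ∀ z v : ℤ × ℤ, WV x η M v.2 (v.1 + v.2) →
      ∃ w : ℤ × ℤ, WV x η M w.2 (w.1 + w.2) ∧ tau2 r ε (z + v) = tau2 r ε z + w := by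
    intro z v hv
    set A : ℝ := r.1 * (z.1 : ℝ) + r.2 * (z.2 : ℝ) + ε with hA
    set B : ℝ := r.1 * ((z + v).1 : ℝ) + r.2 * ((z + v).2 : ℝ) + ε with hB
    have hAB : B - A = v.2 + (x * ((v.1 + v.2 : ℤ) : ℝ) - η * v.2) := by
      simp only [hA, hB, hr, Prod.fst_add, Prod.snd_add]
      push_cast
      ring
    have a1 := Int.floor_le A
    have a2 := Int.lt_floor_add_one A
    have b1 := Int.floor_le B
    have b2 := Int.lt_floor_add_one B
    refine ⟨(v.2, -(⌊B⌋ - ⌊A⌋)), ?_, ?_⟩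
    · have := (WV.closed he h1 h2 h3 h5 hM1 hM2 hM3 hM4 he2 hv (⌊B⌋ - ⌊A⌋ - v.2)
        (by push_cast at *; linarith) (by push_cast at *; linarith)).neg
      convert this using 1 <;> simp <;> ring
    · simp only [tau2, Prod.mk_add_mk, Prod.mk.injEq]
      refine ⟨rfl, ?_⟩
      rw [← hA, ← hB]
      ring
  have clos_it : ∀ (k : ℕ) (z v : ℤ × ℤ), WV x η M v.2 (v.1 + v.2) →
      ∃ w : ℤ × ℤ, WV x η M w.2 (w.1 + w.2) ∧
        (tau2 r ε)^[k] (z + v) = (tau2 r ε)^[k] z + w := by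
    intro k
    induction k with
    | zero => intro z v hv; exact ⟨v, hv, rfl⟩
    | succ k ih =>
      intro z v hv
      obtain ⟨w, hw, e⟩ := clos z v hv
      obtain ⟨w', hw', e'⟩ := ih (tau2 r ε z) w hw
      exact ⟨w', hw', by rw [Function.iterate_succ_apply, Function.iterate_succ_apply, e, e']⟩
  have Gadd : ∀ z v : ℤ × ℤ, WV x η M v.2 (v.1 + v.2) → G z → G (z + v) := by
    rintro z v hv ⟨k, hk⟩
    obtain ⟨w, hw, e⟩ := clos_it k z v hv
    obtain ⟨j, hj⟩ := wit w hw
    refine ⟨j + k, ?_⟩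
    rw [Function.iterate_add_apply, e, hk]
    have hz : ((0, 0) : ℤ × ℤ) + w = w := zero_add w
    rw [hz]
    exact hj
  have p1 : WV x η M 0 1 := by
    right; left; refine ⟨rfl, ?_, ?_⟩ <;> push_cast <;> linarith
  have p2 : WV x η M 1 1 := by
    right; left; refine ⟨rfl, ?_, ?_⟩ <;> push_cast <;> linarith
  have hx : ∀ i : ℤ, G (i, 0) := by
    intro i
    induction i using Int.induction_on with
    | zero => exact G0
    | succ i ih =>
      have := Gadd _ (1, 0) (by simpa using p1) ih
      simpa using this
    | pred i ih =>
      have := Gadd _ (-1, 0) (by simpa using p1.neg) ih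
      simpa [sub_eq_add_neg] using this
  rintro ⟨i, j⟩
  show G (i, j)
  induction j using Int.induction_on with
  | zero => exact hx i
  | succ j ih =>
    have := Gadd _ (0, 1) (by simpa using p2) ih
    simpa using this
  | pred j ih =>
    have := Gadd _ (0, -1) (by simpa using p2.neg) ih
    simpa [sub_eq_add_neg] using this

theorem W_not_mem {ε : ℝ} (he : 0 < ε) (he2 : ε ≤ 2 / 21) : ((ε, 1) : ℝ × ℝ) ∉ SRS2 ε := by
  intro h
  obtain ⟨k, hk⟩ := h (-1, 1)
  have e1 : tau2 (ε, 1) ε (-1, 1) = (1, -1) := by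
    simp only [tau2, Prod.mk.injEq, true_and]
    rw [neg_inj, Int.floor_eq_iff]
    push_cast
    constructor <;> linarith
  have e2 : tau2 (ε, 1) ε (1, -1) = (-1, 1) := by
    simp only [tau2, Prod.mk.injEq, true_and]
    rw [neg_eq_iff_eq_neg, Int.floor_eq_iff]
    push_cast
    constructor <;> linarith
  have : ∀ k : ℕ, (tau2 (ε, 1) ε)^[k] (-1, 1) = (-1, 1) ∨
      (tau2 (ε, 1) ε)^[k] (-1, 1) = (1, -1) := by
    intro k
    induction k with
    | zero => left; rfl
    | succ k ih =>
      rw [Function.iterate_succ_apply']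
      rcases ih with ih | ih
      · right; rw [ih, e1]
      · left; rw [ih, e2]
  rcases this k with h | h <;> rw [hk] at h <;> simp at h


set_option maxHeartbeats 1000000 in
theorem stmt_19 (n : ℕ) (hn : 4 ≤ n) (ε : ℝ)
    (hε0 : 2 / (3 * (2 * (n : ℝ) + 1)) ≤ ε)
    (hε1 : ε < 2 / (3 * (2 * (n : ℝ) - 1)))
    (l : ℕ) (hl : l = (2 * n ^ 2 - 3 * n) / 4 + 1)
    (s : ℕ) (hs2 : 2 ≤ s) (hsl : s ≤ l - 1) :
    convexHull ℝ ({(ε, 1),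
        (2/3 - ε, 5/3 - 2*ε - (s : ℝ) * ε / (n : ℝ)),
        (2/3 - ε, 5/3 - 2*ε - ((s : ℝ) + 1) * ε / (n : ℝ))} : Set (ℝ × ℝ)) ∩
        SRS2 ε =
      convexHull ℝ ({(ε, 1),
        (2/3 - ε, 5/3 - 2*ε - (s : ℝ) * ε / (n : ℝ)),
        (2/3 - ε, 5/3 - 2*ε - ((s : ℝ) + 1) * ε / (n : ℝ))} : Set (ℝ × ℝ)) \
        {((ε, 1) : ℝ × ℝ)} := by
  have hnR : (4 : ℝ) ≤ n := by exact_mod_cast hn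
  have hn0 : (0 : ℝ) < n := by linarith
  have he : 0 < ε := lt_of_lt_of_le (by positivity) hε0
  have hε1' : ε * (3 * (2 * (n : ℝ) - 1)) < 2 := (lt_div_iff₀ (by linarith)).1 hε1
  have he2 : ε ≤ 2 / 21 := by nlinarith
  have hl4 : 4 * ((s : ℝ) + 1) ≤ 2 * n ^ 2 - 3 * n + 4 := by
    have h3 : 3 * n ≤ 2 * n ^ 2 := by nlinarith
    have : 4 * (s + 1) + 3 * n ≤ 2 * n ^ 2 + 4 := by omega
    have : (4 * ((s : ℝ) + 1) + 3 * n) ≤ 2 * n ^ 2 + 4 := by exact_mod_cast this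
    linarith
  have hs0 : (2 : ℝ) ≤ s := by exact_mod_cast hs2
  set q : ℝ := ((s : ℝ) + 1) * ε / n with hq
  set p : ℝ := (s : ℝ) * ε / n with hp
  have hqn : q * n = ((s : ℝ) + 1) * ε := by rw [hq]; field_simp
  have hp0 : 0 < p := by rw [hp]; positivity
  have hpq : p ≤ q := by
    rw [hp, hq]; gcongr; linarith
  have hq6 : q < 1 / 6 := by
    have : q * n < 1 / 6 * n := by
      rw [hqn]; nlinarith
    exact lt_of_mul_lt_mul_right this hn0.le
  have hq3 : 3 * q < 2 / 3 - 2 * ε := by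
    have : 3 * q * n < (2 / 3 - 2 * ε) * n := by
      rw [mul_assoc, hqn]; nlinarith
    exact lt_of_mul_lt_mul_right this hn0.le
  ext r
  simp only [Set.mem_inter_iff, Set.mem_sdiff, Set.mem_singleton_iff]
  refine and_congr_right fun hr => ⟨fun h hW => W_not_mem he he2 (hW ▸ h), fun hW => ?_⟩
  rw [convexHull_insert (by simp), convexHull_pair, mem_convexJoin] at hr
  obtain ⟨w0, hw0, y, ⟨u, v, hu, hv, huv, rfl⟩, ⟨A, B, hA, hB, hAB, rfl⟩⟩ := hr
  rw [Set.mem_singleton_iff] at hw0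
  subst hw0
  have hB0 : 0 < B := by
    rcases hB.eq_or_lt with h | h
    · exfalso
      apply hW
      subst h
      have : A = 1 := by linarith
      subst this
      simp
    · exact h
  set w : ℝ := u * p + v * q with hw
  have hw1 : p ≤ w := by
    have := mul_le_mul_of_nonneg_left hpq hv
    have h1 : u * p + v * p = p := by rw [← add_mul, huv, one_mul]
    linarith
  have hw2 : w ≤ q := by
    have := mul_le_mul_of_nonneg_left hpq hu
    have h1 : u * q + v * q = q := by rw [← add_mul, huv, one_mul]
    linarith
  have hA' : A = 1 - B := by linarith
  have hB1 : B ≤ 1 := by linarith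
  have hu' : u = 1 - v := by linarith
  set x : ℝ := ε + B * (2 / 3 - 2 * ε) with hx
  set η : ℝ := ε + B * w with hη
  have e : A • ((ε, 1) : ℝ × ℝ) + B • (u • ((2/3 - ε, 5/3 - 2*ε - p) : ℝ × ℝ) +
      v • ((2/3 - ε, 5/3 - 2*ε - q) : ℝ × ℝ)) = (x, 1 + x - η) := by
    simp only [Prod.smul_mk, Prod.mk_add_mk, smul_eq_mul, Prod.mk.injEq, hx, hη, hw, hA', hu']
    constructor <;> ring
  rw [e]
  have hBw : B * w ≤ w := mul_le_of_le_one_left (by linarith) hB1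
  have k1 : ε < η := by
    have : 0 < B * w := mul_pos hB0 (by linarith)
    linarith
  have k2 : η ≤ x := by
    have : B * w ≤ B * (2 / 3 - 2 * ε) := mul_le_mul_of_nonneg_left (by linarith) hB
    linarith
  have k3 : x ≤ 2 / 3 - ε := by
    have : B * (2 / 3 - 2 * ε) ≤ 1 * (2 / 3 - 2 * ε) :=
      mul_le_mul_of_nonneg_right hB1 (by linarith)
    linarith
  have k4 : η < 1 / 6 + ε := by linarith
  have k5 : 3 * η < 2 / 3 + ε := by linarith
  refine mem_SRS2_of (M := max x (2 * x - 1 + 2 * η)) he k1 k2 k3 k4 k5 (le_max_left _ _)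
    (le_max_right _ _) ?_ ?_ he2
  · rcases max_cases x (2 * x - 1 + 2 * η) with ⟨h, _⟩ | ⟨h, _⟩ <;> rw [h] <;> linarith
  · rcases max_cases x (2 * x - 1 + 2 * η) with ⟨h, _⟩ | ⟨h, _⟩ <;> rw [h] <;> linarith
end
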